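/- Fix an integer m ≥ 2, and for an integer j ≥ 1 write E_j(t) = (t−1)·∑_{k=1}^{j} (k/j)·binom(2j−k−1, j−1)·t^{k−1}. Then for all real t: (t−1)(E_m(t) − E_m(0)) = t²·E_{m−1}(t), and m·E_m(0) = 2(2m−3)·E_{m−1}(0). -/

import Mathlib

open Set

/-- The polynomial `E_j(t) = (t−1)·∑_{k=1}^j (k/j)·binom(2j−k−1, j−1)·t^{k−1}` of §21. -/
noncomputable def Efun (j : ℕ) : ℝ → ℝ := fun t =>
  (t - 1) * ∑ k ∈ Finset.Icc 1 j,
    ((k : ℝ) / (j : ℝ)) * ((2 * j - k - 1).choose (j - 1) : ℝ) * t ^ (k - 1)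

/-- The coefficient of `t ^ (k - 1)` in `Efun j t / (t - 1)`, a ballot number. -/
noncomputable def ballotCoeff (j k : ℕ) : ℝ :=
  ((k : ℝ) / (j : ℝ)) * ((2 * j - k - 1).choose (j - 1) : ℝ)

theorem Efun_eq_sum_range (j : ℕ) (t : ℝ) :
    Efun j t = (t - 1) * ∑ i ∈ Finset.range j, ballotCoeff j (i + 1) * t ^ i := by
  have h := Finset.sum_Ico_add' (fun k => ballotCoeff j k * t ^ (k - 1)) 0 j 1
  simp only [Nat.add_sub_cancel] at h
  rw [Finset.range_eq_Ico, h]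
  rfl

theorem ballotCoeff_zero_right (j : ℕ) : ballotCoeff j 0 = 0 := by
  simp [ballotCoeff]

theorem ballotCoeff_succ_self (j : ℕ) : ballotCoeff (j + 2) (j + 3) = 0 := by
  have h : (2 * (j + 2) - (j + 3) - 1).choose (j + 2 - 1) = 0 :=
    Nat.choose_eq_zero_of_lt (by omega)
  rw [ballotCoeff, h, Nat.cast_zero, mul_zero]

/-- The Pascal-type recursion of the ballot numbers. -/
theorem ballotCoeff_sub {p k : ℕ} (hk : k ≤ p + 1) :
    ballotCoeff (p + 2) (k + 1) - ballotCoeff (p + 2) (k + 2) = ballotCoeff (p + 1) k := by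
  rcases hk.eq_or_lt with rfl | hk
  · rw [ballotCoeff_succ_self, ballotCoeff, ballotCoeff,
      show 2 * (p + 2) - (p + 1 + 1) - 1 = p + 2 - 1 by omega,
      show 2 * (p + 1) - (p + 1) - 1 = p + 1 - 1 by omega]
    have h₁ : (p : ℝ) + 1 ≠ 0 := by positivity
    have h₂ : (p : ℝ) + 1 + 1 ≠ 0 := by positivity
    have h₃ : (p : ℝ) + 2 ≠ 0 := by positivity
    simp only [Nat.choose_self]
    push_cast
    field_simp
    ring
  · obtain ⟨e, rfl⟩ := Nat.exists_eq_add_of_le (Nat.lt_succ_iff.mp hk)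
    have h := Nat.choose_succ_right_eq (k + e + 1 + e) (k + e)
    rw [show k + e + 1 + e - (k + e) = e + 1 by omega] at h
    have h' : ((k + e + 1 + e).choose (k + e + 1) : ℝ) * (k + e + 1) =
        (k + e + 1 + e).choose (k + e) * (e + 1) := by exact_mod_cast h
    simp only [ballotCoeff]
    rw [show 2 * (k + e + 2) - (k + 1) - 1 = k + e + 1 + e + 1 by omega,
      show 2 * (k + e + 2) - (k + 2) - 1 = k + e + 1 + e by omega,
      show 2 * (k + e + 1) - k - 1 = k + e + 1 + e by omega,
      show k + e + 2 - 1 = k + e + 1 by omega, show k + e + 1 - 1 = k + e by omega,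
      Nat.choose_succ_succ]
    have h₁ : (k : ℝ) + e + 1 ≠ 0 := by positivity
    have h₂ : (k : ℝ) + e + 2 ≠ 0 := by positivity
    push_cast
    field_simp
    linear_combination -h'

theorem Efun_zero (j : ℕ) : Efun (j + 1) 0 = -ballotCoeff (j + 1) 1 := by
  rw [Efun_eq_sum_range, Finset.sum_range_succ']
  simp

theorem ballotCoeff_one (j : ℕ) :
    ((j : ℝ) + 1) * ballotCoeff (j + 1) 1 = j.centralBinom := by
  have h : (j : ℝ) + 1 ≠ 0 := by positivity
  rw [ballotCoeff, Nat.centralBinom, show 2 * (j + 1) - 1 - 1 = 2 * j by omega,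
    Nat.add_sub_cancel]
  push_cast
  field_simp

theorem sub_one_mul_sum_ballotCoeff (n : ℕ) (t : ℝ) :
    (t - 1) * ∑ i ∈ Finset.range (n + 2), ballotCoeff (n + 2) (i + 1) * t ^ i +
        ballotCoeff (n + 2) 1 =
      t ^ 2 * ∑ i ∈ Finset.range (n + 1), ballotCoeff (n + 1) (i + 1) * t ^ i := by
  have hshift : ∑ i ∈ Finset.range (n + 2), ballotCoeff (n + 2) (i + 1) * t ^ i =
      ∑ i ∈ Finset.range (n + 2), ballotCoeff (n + 2) (i + 2) * t ^ (i + 1) +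
        ballotCoeff (n + 2) 1 := by
    have h := Finset.sum_range_succ' (fun i => ballotCoeff (n + 2) (i + 1) * t ^ i) (n + 2)
    rw [Finset.sum_range_succ, ballotCoeff_succ_self] at h
    simpa using h
  have hrec : ∑ i ∈ Finset.range (n + 2), ballotCoeff (n + 2) (i + 1) * t ^ (i + 1) -
        ∑ i ∈ Finset.range (n + 2), ballotCoeff (n + 2) (i + 2) * t ^ (i + 1) =
      ∑ i ∈ Finset.range (n + 2), ballotCoeff (n + 1) i * t ^ (i + 1) := by
    rw [← Finset.sum_sub_distrib]
    refine Finset.sum_congr rfl fun i hi => ?_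
    rw [← ballotCoeff_sub (Nat.lt_succ_iff.mp (Finset.mem_range.mp hi)), sub_mul]
  rw [Finset.sum_range_succ' (fun i => ballotCoeff (n + 1) i * t ^ (i + 1)), ballotCoeff_zero_right, zero_mul, add_zero] at hrec
  have hmul : t * ∑ i ∈ Finset.range (n + 2), ballotCoeff (n + 2) (i + 1) * t ^ i =
      ∑ i ∈ Finset.range (n + 2), ballotCoeff (n + 2) (i + 1) * t ^ (i + 1) := by
    rw [Finset.mul_sum]
    exact Finset.sum_congr rfl fun i _ => by ring
  have hmul' : t ^ 2 * ∑ i ∈ Finset.range (n + 1), ballotCoeff (n + 1) (i + 1) * t ^ i =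
      ∑ i ∈ Finset.range (n + 1), ballotCoeff (n + 1) (i + 1) * t ^ (i + 1 + 1) := by
    rw [Finset.mul_sum]
    exact Finset.sum_congr rfl fun i _ => by ring
  linear_combination hmul - hshift + hrec - hmul'

/-- Recursion formulas for the polynomials `E_j`. -/
theorem stmt_10 (m : ℕ) (hm : 2 ≤ m) :
    ∀ t : ℝ,
      (t - 1) * (Efun m t - Efun m 0) = t ^ 2 * Efun (m - 1) t ∧
      (m : ℝ) * Efun m 0 = 2 * (2 * (m : ℝ) - 3) * Efun (m - 1) 0 := by
  intro t
  obtain ⟨n, rfl⟩ := Nat.exists_eq_add_of_le' hm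
  rw [show n + 2 - 1 = n + 1 by omega, Efun_zero (n + 1), Efun_zero n]
  constructor
  · rw [Efun_eq_sum_range, Efun_eq_sum_range]
    linear_combination (t - 1) * sub_one_mul_sum_ballotCoeff n t
  · have h₁ := ballotCoeff_one (n + 1)
    have h₂ := ballotCoeff_one n
    have h₃ : ((n : ℝ) + 1) * (n + 1).centralBinom = 2 * (2 * n + 1) * n.centralBinom := by
      exact_mod_cast Nat.succ_mul_centralBinom_succ n
    have h : (n : ℝ) + 1 ≠ 0 := by positivity
    refine mul_left_cancel₀ h ?_
    push_cast at h₁ ⊢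
    linear_combination -(n + 1 : ℝ) * h₁ - h₃ + 2 * (2 * n + 1 : ℝ) * h₂
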